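/- Let N ≥ 1 be an integer and (λ_n)_{n∈ℕ} a sequence in 𝔻∖{0} with Σ_{n∈ℕ} (1−|λ_n|²)/|1−λ_n|^{2N} < ∞ (in particular Σ(1−|λ_n|) < ∞, so the Blaschke product B_Λ converges). Then there exist g ∈ H² and a polynomial p of degree < N such that B_Λ(z) = (z−1)^N g(z) + p(z) for all z ∈ 𝔻 (equivalently, D₁^N(B_Λ) < ∞); moreover lim_{r→1⁻} |B_Λ(r)| = 1. -/

import Mathlib

open Complex MeasureTheory Metric Set Finset Filter Polynomial
open scoped ENNReal NNReal Topology

noncomputable section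

/-- Membership in the Hardy space `H²` of the unit disk. -/
def MemHardy2 (f : ℂ → ℂ) : Prop :=
  DifferentiableOn ℂ f (ball (0 : ℂ) 1) ∧
  ∃ C : ℝ, ∀ r : ℝ, 0 < r → r < 1 →
    (1 / (2 * Real.pi)) * ∫ t in (0 : ℝ)..(2 * Real.pi),
      ‖f ((r : ℂ) * Complex.exp ((t : ℂ) * Complex.I))‖ ^ 2 ≤ C

/-- The squared `H²` norm of `f`, as the supremum of the circle means. -/
def h2NormSq (f : ℂ → ℂ) : ℝ :=
  sSup {y : ℝ | ∃ r : ℝ, 0 < r ∧ r < 1 ∧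
    y = (1 / (2 * Real.pi)) * ∫ t in (0 : ℝ)..(2 * Real.pi),
      ‖f ((r : ℂ) * Complex.exp ((t : ℂ) * Complex.I))‖ ^ 2}

/-- The local Dirichlet integral of order `N` at the point `1`:
`D₁^N(h) = inf { ‖(h-q)/(z-1)^N‖²_{H²} : q polynomial, deg q < N, (h-q)/(z-1)^N ∈ H² }`,
with value `∞` if no such `q` exists. -/
def D1N (N : ℕ) (h : ℂ → ℂ) : ℝ≥0∞ :=
  ⨅ (q : Polynomial ℂ) (_ : q.degree < (N : ℕ) ∧
      MemHardy2 fun z => (h z - q.eval z) / (z - 1) ^ N),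
    ENNReal.ofReal (h2NormSq fun z => (h z - q.eval z) / (z - 1) ^ N)


/-- The iterated difference quotient of `f` at the point `1`. -/
def iterSlope (k : ℕ) (f : ℂ → ℂ) : ℂ → ℂ := (fun h => dslope h 1)^[k] f

lemma iterSlope_zero (f : ℂ → ℂ) : iterSlope 0 f = f := rfl

lemma iterSlope_succ (k : ℕ) (f : ℂ → ℂ) : iterSlope (k + 1) f = dslope (iterSlope k f) 1 :=
  Function.iterate_succ_apply' _ _ _

lemma AnalyticAt.dslope_one {f : ℂ → ℂ} {z : ℂ} (h1 : AnalyticAt ℂ f 1) (hz : AnalyticAt ℂ f z) :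
    AnalyticAt ℂ (dslope f 1) z := by
  rcases eq_or_ne z 1 with rfl | hne
  · obtain ⟨p, hp⟩ := h1
    exact ⟨_, hp.has_fpower_series_dslope_fslope⟩
  · have : AnalyticAt ℂ (fun w => (w - 1)⁻¹ * (f w - f 1)) z :=
      ((analyticAt_id.sub analyticAt_const).inv (sub_ne_zero.2 hne)).mul
        (hz.sub analyticAt_const)
    refine this.congr ?_
    filter_upwards [dslope_eventuallyEq_slope_of_ne f hne] with w hw
    rw [hw, slope_def_module, smul_eq_mul]

lemma AnalyticAt.iterSlope {f : ℂ → ℂ} {z : ℂ} (h1 : AnalyticAt ℂ f 1) (hz : AnalyticAt ℂ f z)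
    (k : ℕ) : AnalyticAt ℂ (iterSlope k f) z := by
  suffices H : ∀ k, AnalyticAt ℂ (_root_.iterSlope k f) 1 ∧ AnalyticAt ℂ (_root_.iterSlope k f) z
    from (H k).2
  intro k
  induction k with
  | zero => exact ⟨h1, hz⟩
  | succ k ih =>
    rw [iterSlope_succ]
    exact ⟨ih.1.dslope_one ih.1, ih.1.dslope_one ih.2⟩

lemma one_mem_closedBall : (1 : ℂ) ∈ closedBall (0 : ℂ) 1 := by simp

lemma AnalyticOnNhd.iterSlope {f : ℂ → ℂ} (hf : AnalyticOnNhd ℂ f (closedBall 0 1)) (k : ℕ) :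
    AnalyticOnNhd ℂ (iterSlope k f) (closedBall 0 1) :=
  fun z hz => (hf 1 one_mem_closedBall).iterSlope (hf z hz) k

lemma dslope_one_of_ne (f : ℂ → ℂ) {z : ℂ} (hz : z ≠ 1) :
    dslope f 1 z = (f z - f 1) / (z - 1) := by
  rw [dslope_of_ne f hz, slope_def_field]

lemma dslope_one_add {f g : ℂ → ℂ} (hf : AnalyticAt ℂ f 1) (hg : AnalyticAt ℂ g 1) :
    dslope (fun z => f z + g z) 1 = fun z => dslope f 1 z + dslope g 1 z := by
  ext z
  rcases eq_or_ne z 1 with rfl | hz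
  · simp only [dslope_same]
    exact deriv_fun_add hf.differentiableAt hg.differentiableAt
  · simp only [dslope_one_of_ne _ hz]
    ring

lemma dslope_one_mul {f g : ℂ → ℂ} (hf : AnalyticAt ℂ f 1) (hg : AnalyticAt ℂ g 1) :
    dslope (fun z => f z * g z) 1 = fun z => f z * dslope g 1 z + g 1 * dslope f 1 z := by
  ext z
  rcases eq_or_ne z 1 with rfl | hz
  · simp only [dslope_same]
    rw [deriv_fun_mul hf.differentiableAt hg.differentiableAt]
    ring
  · simp only [dslope_one_of_ne _ hz]
    ring

lemma dslope_one_sum {ι : Type*} (s : Finset ι) (c : ι → ℂ) {F : ι → ℂ → ℂ}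
    (hF : ∀ i, AnalyticAt ℂ (F i) 1) :
    dslope (fun z => ∑ i ∈ s, c i * F i z) 1 = fun z => ∑ i ∈ s, c i * dslope (F i) 1 z := by
  ext z
  rcases eq_or_ne z 1 with rfl | hz
  · simp only [dslope_same]
    rw [deriv_fun_sum fun i _ => (hF i).differentiableAt.const_mul _]
    exact Finset.sum_congr rfl fun i _ => deriv_const_mul _ (hF i).differentiableAt
  · simp only [dslope_one_of_ne _ hz]
    rw [← Finset.sum_sub_distrib, Finset.sum_div]
    exact Finset.sum_congr rfl fun i _ => by ring

/-- Leibniz rule for iterated difference quotients at `1`. -/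
lemma iterSlope_mul {f g : ℂ → ℂ} (hf : AnalyticAt ℂ f 1) (hg : AnalyticAt ℂ g 1) (k : ℕ) :
    iterSlope k (fun z => f z * g z) = fun z =>
      f z * iterSlope k g z + ∑ j ∈ Finset.range k, iterSlope j g 1 * iterSlope (k - j) f z := by
  induction k with
  | zero => simp [iterSlope_zero]
  | succ k ih =>
    have hf' := hf.iterSlope hf
    have hg' := hg.iterSlope hg
    rw [iterSlope_succ, ih, dslope_one_add (hf.fun_mul (hg' k)), dslope_one_mul hf (hg' k),
      dslope_one_sum _ _ fun j => hf' (k - j)]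
    · ext z
      rw [Finset.sum_range_succ, iterSlope_succ k g]
      have : ∀ j ∈ Finset.range k, iterSlope j g 1 * iterSlope (k + 1 - j) f z =
          iterSlope j g 1 * dslope (iterSlope (k - j) f) 1 z := fun j hj => by
        rw [← iterSlope_succ, Nat.sub_add_comm (Finset.mem_range.1 hj).le]
      rw [Finset.sum_congr rfl this, Nat.add_sub_cancel_left]
      have h1 : iterSlope 1 f z = dslope f 1 z := rfl
      rw [h1]
      ring
    · exact Finset.analyticAt_fun_sum _ fun j _ => analyticAt_const.mul (hf' _)

/-- Taylor's formula at `1`. -/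
lemma eq_sum_add_pow_mul_iterSlope (f : ℂ → ℂ) (k : ℕ) (z : ℂ) :
    f z = ∑ j ∈ Finset.range k, iterSlope j f 1 * (z - 1) ^ j + (z - 1) ^ k * iterSlope k f z := by
  induction k with
  | zero => simp [iterSlope_zero]
  | succ k ih =>
    have h := sub_smul_dslope (iterSlope k f) 1 z
    rw [← iterSlope_succ, smul_eq_mul] at h
    rw [Finset.sum_range_succ, pow_succ, mul_assoc, h]
    nth_rw 1 [ih]
    ring

lemma dslope_one_congr {f g : ℂ → ℂ} {U : Set ℂ} (hU : IsOpen U) (h1 : (1 : ℂ) ∈ U)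
    (h : EqOn f g U) : EqOn (dslope f 1) (dslope g 1) U := by
  intro z hz
  rcases eq_or_ne z 1 with rfl | hne
  · simp only [dslope_same]
    exact (h.eventuallyEq_of_mem (hU.mem_nhds h1)).deriv_eq
  · rw [dslope_one_of_ne _ hne, dslope_one_of_ne _ hne, h hz, h h1]

/-- The mean of `‖f‖²` over the circle of radius `r` centred at the origin. -/
def circleMeanSq (f : ℂ → ℂ) (r : ℝ) : ℝ := Real.circleAverage (fun z => ‖f z‖ ^ 2) 0 r

lemma circleMeanSq_nonneg (f : ℂ → ℂ) (r : ℝ) : 0 ≤ circleMeanSq f r :=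
  Real.circleAverage_nonneg_of_nonneg fun _ _ => by positivity

lemma circleMeanSq_congr {f g : ℂ → ℂ} (h : ∀ z ∈ sphere (0 : ℂ) 1, ‖f z‖ = ‖g z‖) :
    circleMeanSq f 1 = circleMeanSq g 1 :=
  Real.circleAverage_congr_sphere fun z hz => by
    simp only [h z (by simpa using hz)]

lemma AnalyticOnNhd.continuousOn_sphere {f : ℂ → ℂ} (hf : AnalyticOnNhd ℂ f (closedBall 0 1)) :
    ContinuousOn f (sphere (0 : ℂ) 1) :=
  hf.continuousOn.mono sphere_subset_closedBall

lemma ContinuousOn.circleIntegrable_normSq {f : ℂ → ℂ} (hf : ContinuousOn f (sphere (0 : ℂ) 1)) :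
    CircleIntegrable (fun z => ‖f z‖ ^ 2) 0 1 :=
  (hf.norm.pow 2).circleIntegrable zero_le_one

lemma AnalyticOnNhd.diffContOnCl {f : ℂ → ℂ} (hf : AnalyticOnNhd ℂ f (closedBall 0 1)) :
    DiffContOnCl ℂ f (ball 0 1) :=
  DifferentiableOn.diffContOnCl
    (hf.differentiableOn.mono (by rw [closure_ball _ one_ne_zero]))

lemma star_eq_inv_of_mem_sphere {z : ℂ} (hz : z ∈ sphere (0 : ℂ) 1) :
    (starRingEnd ℂ) z = z⁻¹ := by
  rw [Complex.inv_def, Complex.normSq_eq_norm_sq]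
  simp [mem_sphere_zero_iff_norm.1 hz]

lemma eq_at_one_of_eqOn_sphere {u v : ℂ → ℂ} (hu : ContinuousAt u 1) (hv : ContinuousAt v 1)
    (h : ∀ z ∈ sphere (0 : ℂ) 1, z ≠ 1 → u z = v z) : u 1 = v 1 := by
  have hγ : ContinuousAt (circleMap 0 1) 0 := (continuous_circleMap 0 1).continuousAt
  have h0 : circleMap 0 1 0 = 1 := by simp [circleMap]
  have hu' : ContinuousAt (u ∘ circleMap 0 1) 0 := ContinuousAt.comp (by rwa [h0]) hγ
  have hv' : ContinuousAt (v ∘ circleMap 0 1) 0 := ContinuousAt.comp (by rwa [h0]) hγ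
  have key : u ∘ circleMap 0 1 =ᶠ[𝓝[≠] 0] v ∘ circleMap 0 1 := by
    have hI : Ioo (-Real.pi) Real.pi ∈ 𝓝 (0 : ℝ) :=
      Ioo_mem_nhds (by linarith [Real.pi_pos]) Real.pi_pos
    filter_upwards [nhdsWithin_le_nhds hI, self_mem_nhdsWithin] with t ht ht0
    refine h _ (circleMap_mem_sphere _ zero_le_one _) fun h1 => ht0 ?_
    have : Complex.arg (Complex.exp (t * I)) = t := by
      rw [Complex.arg_exp_mul_I, toIocMod_eq_self]
      constructor
      · exact ht.1
      · linarith [ht.2]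
    rw [show circleMap 0 1 t = Complex.exp (t * I) by simp [circleMap]] at h1
    rw [h1, Complex.arg_one] at this
    exact this.symm
  have := ((hu'.eventuallyEq_nhds_iff_eventuallyEq_nhdsNE hv').1 key).eq_of_nhds
  simpa [h0] using this

/-- A function that is holomorphic across the closed unit disk and unimodular on the circle. -/
structure IsInner (f : ℂ → ℂ) : Prop where
  analytic : AnalyticOnNhd ℂ f (closedBall 0 1)
  norm_eq : ∀ z ∈ sphere (0 : ℂ) 1, ‖f z‖ = 1

lemma IsInner.mul {f g : ℂ → ℂ} (hf : IsInner f) (hg : IsInner g) :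
    IsInner fun z => f z * g z :=
  ⟨fun z hz => (hf.analytic z hz).fun_mul (hg.analytic z hz), fun z hz => by
    simp [hf.norm_eq z hz, hg.norm_eq z hz]⟩

lemma isInner_one : IsInner fun _ => 1 := ⟨fun _ _ => analyticAt_const, fun _ _ => by simp⟩

lemma IsInner.exists_mul_star_iterSlope {f : ℂ → ℂ} (hf : IsInner f) (k : ℕ) :
    ∃ G : ℂ → ℂ, AnalyticOnNhd ℂ G (closedBall 0 1) ∧
      ∀ z ∈ sphere (0 : ℂ) 1,
        f z * (starRingEnd ℂ) (iterSlope k f z) = (if k = 0 then 1 else z) * G z := by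
  have h1S : (1 : ℂ) ∈ sphere (0 : ℂ) 1 := by simp
  induction k with
  | zero =>
    refine ⟨fun _ => 1, fun _ _ => analyticAt_const, fun z hz => ?_⟩
    rw [iterSlope_zero, Complex.mul_conj, Complex.normSq_eq_norm_sq, hf.norm_eq z hz]
    simp
  | succ k ih =>
    obtain ⟨G, hG, hGeq⟩ := ih
    set a := (starRingEnd ℂ) (iterSlope k f 1) with ha
    set H : ℂ → ℂ := fun z => (if k = 0 then 1 else z) * G z - a * f z with hH
    have hHan : AnalyticOnNhd ℂ H (closedBall 0 1) := by
      intro z hz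
      have : AnalyticAt ℂ (fun z : ℂ => if k = 0 then 1 else z) z := by
        split_ifs
        · exact analyticAt_const
        · exact analyticAt_id
      exact (this.fun_mul (hG z hz)).fun_sub (analyticAt_const.fun_mul (hf.analytic z hz))
    have hH1 : H 1 = 0 := by
      rw [hH]
      simp only
      rw [← hGeq 1 h1S, ha]
      ring
    have hD : AnalyticOnNhd ℂ (fun z => - dslope H 1 z) (closedBall 0 1) := fun z hz =>
      ((hHan 1 one_mem_closedBall).dslope_one (hHan z hz)).fun_neg
    refine ⟨_, hD, ?_⟩
    have hne : ∀ z ∈ sphere (0 : ℂ) 1, z ≠ 1 →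
        f z * (starRingEnd ℂ) (iterSlope (k + 1) f z) = z * - dslope H 1 z := by
      intro z hz hz1
      have hz0 : z ≠ 0 := ne_zero_of_mem_unit_sphere ⟨z, hz⟩
      have hz1' : z - 1 ≠ 0 := sub_ne_zero.2 hz1
      have hz1'' : z⁻¹ - 1 ≠ 0 := fun h => hz1 (by rw [sub_eq_zero] at h; simpa using h)
      rw [iterSlope_succ, dslope_one_of_ne _ hz1, dslope_one_of_ne _ hz1, hH1, map_div₀, map_sub,
        map_sub, map_one, star_eq_inv_of_mem_sphere hz, ← ha, hH]
      simp only
      rw [← hGeq z hz]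
      have : z⁻¹ - 1 = - (z - 1) / z := by field_simp; ring
      rw [this]
      field_simp
      ring
    intro z hz
    simp only [Nat.add_eq_zero_iff, one_ne_zero, and_false, if_false]
    rcases eq_or_ne z 1 with rfl | hz1
    · refine eq_at_one_of_eqOn_sphere (u := fun z => f z * (starRingEnd ℂ) (iterSlope (k + 1) f z))
        (v := fun z => z * - dslope H 1 z) ?_ ?_ hne
      · exact (hf.analytic 1 one_mem_closedBall).continuousAt.mul
          (Complex.continuous_conj.continuousAt.comp
            (hf.analytic.iterSlope (k + 1) 1 one_mem_closedBall).continuousAt)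
      · exact continuousAt_id.mul (hD 1 one_mem_closedBall).continuousAt
    · exact hne z hz hz1

lemma IsInner.circleAverage_mul_star_iterSlope {f h : ℂ → ℂ} (hf : IsInner f)
    (hh : AnalyticOnNhd ℂ h (closedBall 0 1)) {k : ℕ} (hk : k ≠ 0) :
    Real.circleAverage (fun z => f z * h z * (starRingEnd ℂ) (iterSlope k f z)) 0 1 = 0 := by
  obtain ⟨G, hG, hGeq⟩ := hf.exists_mul_star_iterSlope k
  have : Real.circleAverage (fun z => f z * h z * (starRingEnd ℂ) (iterSlope k f z)) 0 1 =
      Real.circleAverage (fun z => z * (G z * h z)) 0 1 :=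
    Real.circleAverage_congr_sphere fun z hz => by
      have := hGeq z (by simpa using hz)
      rw [if_neg hk] at this
      linear_combination h z * this
  rw [this]
  have han : AnalyticOnNhd ℂ (fun z => z * (G z * h z)) (closedBall 0 1) :=
    fun z hz => analyticAt_id.fun_mul ((hG z hz).fun_mul (hh z hz))
  have := DiffContOnCl.circleAverage (R := 1) (c := 0) (by simpa using han.diffContOnCl)
  simpa using this

/-- Orthogonality of `f H²` and the span of the difference quotients of an inner function `f`. -/
lemma IsInner.circleMeanSq_mul_add {f h : ℂ → ℂ} (hf : IsInner f)
    (hh : AnalyticOnNhd ℂ h (closedBall 0 1)) (k : ℕ) (c : ℕ → ℂ) :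
    circleMeanSq (fun z => f z * h z + ∑ j ∈ Finset.range k, c j * iterSlope (k - j) f z) 1 =
      circleMeanSq h 1 +
        circleMeanSq (fun z => ∑ j ∈ Finset.range k, c j * iterSlope (k - j) f z) 1 := by
  set F : ℂ → ℂ := fun z => ∑ j ∈ Finset.range k, c j * iterSlope (k - j) f z with hF
  have hfc := hf.analytic.continuousOn_sphere
  have hhc := hh.continuousOn_sphere
  have hDc : ∀ j, ContinuousOn (iterSlope j f) (sphere (0 : ℂ) 1) := fun j =>
    (hf.analytic.iterSlope j).continuousOn_sphere
  have hFc : ContinuousOn F (sphere (0 : ℂ) 1) :=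
    continuousOn_finsetSum _ fun j _ => continuousOn_const.mul (hDc _)
  have hcross : Real.circleAverage (fun z => f z * h z * (starRingEnd ℂ) (F z)) 0 1 = 0 := by
    have e : (fun z => f z * h z * (starRingEnd ℂ) (F z)) = fun z => ∑ j ∈ Finset.range k,
        (starRingEnd ℂ) (c j) • (f z * h z * (starRingEnd ℂ) (iterSlope (k - j) f z)) := by
      ext z
      simp only [hF, map_sum, map_mul, Finset.mul_sum, smul_eq_mul]
      exact Finset.sum_congr rfl fun j _ => by ring
    rw [e, Real.circleAverage_fun_sum]
    · refine Finset.sum_eq_zero fun j hj => ?_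
      rw [Real.circleAverage_fun_smul, hf.circleAverage_mul_star_iterSlope hh, smul_zero]
      have := Finset.mem_range.1 hj
      omega
    · intro j _
      have : ContinuousOn (fun z => f z * h z * (starRingEnd ℂ) (iterSlope (k - j) f z))
          (sphere 0 1) :=
        (hfc.mul hhc).mul (Complex.continuous_conj.comp_continuousOn (hDc _))
      exact (this.const_smul ((starRingEnd ℂ) (c j))).circleIntegrable zero_le_one
  have hci : ContinuousOn (fun z => f z * h z * (starRingEnd ℂ) (F z)) (sphere (0 : ℂ) 1) :=
    (hfc.mul hhc).mul (Complex.continuous_conj.comp_continuousOn hFc)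
  have hre : Real.circleAverage (fun z => (f z * h z * (starRingEnd ℂ) (F z)).re) 0 1 = 0 := by
    have := Complex.reCLM.circleAverage_comp_comm (hci.circleIntegrable zero_le_one)
    rw [hcross, map_zero] at this
    exact this
  have hpt : circleMeanSq (fun z => f z * h z + F z) 1 = Real.circleAverage
      (fun z => (‖h z‖ ^ 2 + ‖F z‖ ^ 2) + (2 : ℝ) • (f z * h z * (starRingEnd ℂ) (F z)).re) 0 1 :=
    Real.circleAverage_congr_sphere fun z hz => by
      have h1 := hf.norm_eq z (by simpa using hz)
      simp only [← Complex.normSq_eq_norm_sq, Complex.normSq_add, smul_eq_mul]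
      rw [Complex.normSq_mul, Complex.normSq_eq_norm_sq (f z), h1]
      ring
  have hi₁ : CircleIntegrable (fun z => ‖h z‖ ^ 2 + ‖F z‖ ^ 2) 0 1 :=
    hhc.circleIntegrable_normSq.add hFc.circleIntegrable_normSq
  have hi₂ : CircleIntegrable
      (fun z => (2 : ℝ) • (f z * h z * (starRingEnd ℂ) (F z)).re) 0 1 :=
    ((Complex.continuous_re.comp_continuousOn hci).const_smul (2 : ℝ)).circleIntegrable zero_le_one
  rw [hpt, Real.circleAverage_fun_add hi₁ hi₂,
    Real.circleAverage_fun_add hhc.circleIntegrable_normSq hFc.circleIntegrable_normSq,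
    Real.circleAverage_fun_smul, hre, smul_zero, add_zero]
  rfl

lemma continuousOn_poissonKernel_sphere {w : ℂ} (hw : w ∈ ball (0 : ℂ) 1) :
    ContinuousOn (poissonKernel 0 w) (sphere (0 : ℂ) 1) := by
  unfold poissonKernel
  refine ContinuousOn.div (by fun_prop) (by fun_prop) fun z hz h => ?_
  rw [mem_sphere_zero_iff_norm] at hz
  rw [mem_ball_zero_iff] at hw
  have : z = w := by simpa [sub_eq_zero] using h
  exact hw.ne (this ▸ hz)

lemma circleAverage_poissonKernel {w : ℂ} (hw : w ∈ ball (0 : ℂ) 1) :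
    Real.circleAverage (poissonKernel 0 w) 0 1 = 1 := by
  have h := DiffContOnCl.circleAverage_poissonKernel_smul (f := fun _ => (1 : ℂ)) (R := 1)
    diffContOnCl_const hw
  have hc := (continuousOn_poissonKernel_sphere hw).circleIntegrable zero_le_one
  have h' := Complex.ofRealCLM.circleAverage_comp_comm hc
  have e : (poissonKernel 0 w • fun _ => (1 : ℂ)) = Complex.ofRealCLM ∘ poissonKernel 0 w := by
    ext z
    simp
  rw [e, h'] at h
  simpa using h

lemma poissonKernel_nonneg {w z : ℂ} (hw : w ∈ ball (0 : ℂ) 1) (hz : z ∈ sphere (0 : ℂ) 1) :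
    0 ≤ poissonKernel 0 w z := by
  rw [mem_sphere_zero_iff_norm] at hz
  rw [mem_ball_zero_iff] at hw
  unfold poissonKernel
  simp only [sub_zero, hz]
  have : ‖w‖ ^ 2 ≤ 1 := pow_le_one₀ (norm_nonneg _) hw.le
  exact div_nonneg (by linarith) (by positivity)

lemma norm_sq_le_circleAverage_poissonKernel {f : ℂ → ℂ} (hf : AnalyticOnNhd ℂ f (closedBall 0 1))
    {w : ℂ} (hw : w ∈ ball (0 : ℂ) 1) :
    ‖f w‖ ^ 2 ≤ Real.circleAverage (fun z => poissonKernel 0 w z * ‖f z‖ ^ 2) 0 1 := by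
  set P := poissonKernel 0 w with hP
  have hPc : ContinuousOn P (sphere (0 : ℂ) 1) := continuousOn_poissonKernel_sphere hw
  have hfc := hf.continuousOn_sphere
  have hPf : Real.circleAverage (P • f) 0 1 = f w :=
    hf.diffContOnCl.circleAverage_poissonKernel_smul hw
  let L : ℂ →L[ℝ] ℝ :=
    Complex.reCLM.comp (ContinuousLinearMap.mul ℝ ℂ ((starRingEnd ℂ) (f w)))
  have hPfc : ContinuousOn (P • f) (sphere (0 : ℂ) 1) := hPc.smul hfc
  have hL := L.circleAverage_comp_comm (hPfc.circleIntegrable zero_le_one)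
  have hLw : L (f w) = ‖f w‖ ^ 2 := by
    simp only [L, ContinuousLinearMap.comp_apply, ContinuousLinearMap.mul_apply',
      Complex.reCLM_apply]
    rw [mul_comm, Complex.mul_conj, Complex.ofReal_re, Complex.normSq_eq_norm_sq]
  rw [hPf, hLw] at hL
  have h0 : 0 ≤ Real.circleAverage (fun z => P z * ‖f z - f w‖ ^ 2) 0 1 :=
    Real.circleAverage_nonneg_of_nonneg fun z hz =>
      mul_nonneg (poissonKernel_nonneg hw (by simpa using hz)) (by positivity)
  have hexp : Real.circleAverage (fun z => P z * ‖f z - f w‖ ^ 2) 0 1 =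
      Real.circleAverage (fun z => (P z * ‖f z‖ ^ 2 + (‖f w‖ ^ 2) • P z) -
        (2 : ℝ) • (L ∘ (P • f)) z) 0 1 :=
    Real.circleAverage_congr_sphere fun z _ => by
      simp only [L, ← Complex.normSq_eq_norm_sq, Complex.normSq_sub, smul_eq_mul,
        Function.comp_apply, ContinuousLinearMap.comp_apply, ContinuousLinearMap.mul_apply',
        Complex.reCLM_apply, Pi.smul_apply', Complex.real_smul]
      rw [show (starRingEnd ℂ) (f w) * (↑(P z) * f z) =
        (P z : ℂ) * (f z * (starRingEnd ℂ) (f w)) by ring, Complex.re_ofReal_mul]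
      ring
  have i1 : CircleIntegrable (fun z => P z * ‖f z‖ ^ 2) 0 1 :=
    (hPc.mul (hfc.norm.pow 2)).circleIntegrable zero_le_one
  have i2 : CircleIntegrable (fun z => (‖f w‖ ^ 2) • P z) 0 1 :=
    (hPc.const_smul (‖f w‖ ^ 2)).circleIntegrable zero_le_one
  have i3 : CircleIntegrable (fun z => (2 : ℝ) • (L ∘ (P • f)) z) 0 1 :=
    ((L.continuous.comp_continuousOn hPfc).const_smul (2 : ℝ)).circleIntegrable zero_le_one
  have i12 : CircleIntegrable (fun z => P z * ‖f z‖ ^ 2 + (‖f w‖ ^ 2) • P z) 0 1 := i1.add i2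
  rw [hexp, Real.circleAverage_fun_sub i12 i3, Real.circleAverage_fun_add i1 i2,
    Real.circleAverage_fun_smul, Real.circleAverage_fun_smul, circleAverage_poissonKernel hw,
    hL, smul_eq_mul, smul_eq_mul] at h0
  linarith

lemma norm_sub_mul_comm {z w : ℂ} (hz : ‖z‖ = 1) (hw : ‖w‖ = 1) (r : ℝ) :
    ‖z - r * w‖ = ‖w - r * z‖ := by
  have h : ‖z - r * w‖ ^ 2 = ‖w - r * z‖ ^ 2 := by
    simp only [← Complex.normSq_eq_norm_sq, Complex.normSq_sub,
      Complex.normSq_eq_norm_sq z, Complex.normSq_eq_norm_sq w, hz, hw, map_mul,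
      Complex.conj_ofReal]
    have : (z * (↑r * (starRingEnd ℂ) w)).re = (w * (↑r * (starRingEnd ℂ) z)).re := by
      simp
      ring
    rw [this]
  exact (sq_eq_sq₀ (norm_nonneg _) (norm_nonneg _)).1 h

/-- The circle means of `‖f‖²` are bounded by the mean over the unit circle. -/
lemma AnalyticOnNhd.circleMeanSq_le {f : ℂ → ℂ} (hf : AnalyticOnNhd ℂ f (closedBall 0 1))
    {r : ℝ} (hr0 : 0 < r) (hr1 : r < 1) : circleMeanSq f r ≤ circleMeanSq f 1 := by
  have hrw : ∀ w ∈ sphere (0 : ℂ) 1, (r * w : ℂ) ∈ ball (0 : ℂ) 1 := fun w hw => by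
    rw [mem_sphere_zero_iff_norm] at hw
    simpa [hw, abs_of_pos hr0] using hr1
  set γ : ℝ → ℂ := circleMap 0 1 with hγ
  have hγs : ∀ t, γ t ∈ sphere (0 : ℂ) 1 := fun t => circleMap_mem_sphere _ zero_le_one _
  have hγn : ∀ t, ‖γ t‖ = 1 := fun t => mem_sphere_zero_iff_norm.1 (hγs t)
  have hγc : Continuous γ := continuous_circleMap 0 1
  set K : ℝ → ℝ → ℝ := fun s t => poissonKernel 0 (r * γ s) (γ t) with hK
  have hKc : Continuous (fun p : ℝ × ℝ => K p.1 p.2) := by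
    simp only [hK, poissonKernel]
    refine Continuous.div (by fun_prop) (by fun_prop) fun p h => ?_
    have h1 : γ p.2 = r * γ p.1 := by simpa [sub_eq_zero] using h
    have h2 := mem_ball_zero_iff.1 (hrw _ (hγs p.1))
    rw [← h1, hγn] at h2
    exact lt_irrefl _ h2
  have hKsymm : ∀ s t, K s t = K t s := fun s t => by
    simp only [hK, poissonKernel, sub_zero, norm_mul, hγn]
    rw [norm_sub_mul_comm (hγn t) (hγn s)]
  set F : ℝ → ℝ := fun t => ‖f (γ t)‖ ^ 2 with hF
  have hFc : Continuous F := by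
    have : Continuous fun t => f (γ t) :=
      hf.continuousOn_sphere.comp_continuous hγc hγs
    exact this.norm.pow 2
  have hFrc : Continuous fun s => ‖f (r * γ s)‖ ^ 2 := by
    have : Continuous fun s => f (r * γ s) :=
      hf.continuousOn.comp_continuous (by fun_prop) fun s => ball_subset_closedBall (hrw _ (hγs s))
    exact this.norm.pow 2
  have hK1 : ∀ t, (2 * Real.pi)⁻¹ * ∫ s in (0 : ℝ)..2 * Real.pi, K s t = 1 := fun t => by
    simp_rw [hKsymm _ t]
    exact circleAverage_poissonKernel (hrw _ (hγs t))
  have hpt : ∀ s, ‖f (r * γ s)‖ ^ 2 ≤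
      (2 * Real.pi)⁻¹ * ∫ t in (0 : ℝ)..2 * Real.pi, K s t * F t := fun s =>
    norm_sq_le_circleAverage_poissonKernel hf (hrw _ (hγs s))
  have hKF : Continuous (fun p : ℝ × ℝ => K p.1 p.2 * F p.2) := by fun_prop
  have hI : Continuous fun s => ∫ t in (0 : ℝ)..2 * Real.pi, K s t * F t :=
    intervalIntegral.continuous_parametric_intervalIntegral_of_continuous' hKF _ _
  have hpi : (0 : ℝ) ≤ 2 * Real.pi := Real.two_pi_pos.le
  calc circleMeanSq f r
      = (2 * Real.pi)⁻¹ * ∫ s in (0 : ℝ)..2 * Real.pi, ‖f (r * γ s)‖ ^ 2 := by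
        rw [circleMeanSq, Real.circleAverage_eq_circleAverage_zero_one, Real.circleAverage_def]
        simp [hγ]
    _ ≤ (2 * Real.pi)⁻¹ * ∫ s in (0 : ℝ)..2 * Real.pi,
          (2 * Real.pi)⁻¹ * ∫ t in (0 : ℝ)..2 * Real.pi, K s t * F t := by
        refine mul_le_mul_of_nonneg_left ?_ (by positivity)
        exact intervalIntegral.integral_mono hpi (hFrc.intervalIntegrable _ _)
          ((hI.const_mul _).intervalIntegrable _ _) hpt
    _ = (2 * Real.pi)⁻¹ * ∫ t in (0 : ℝ)..2 * Real.pi, F t := by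
        congr 1
        rw [intervalIntegral.integral_const_mul, intervalIntegral_intervalIntegral_swap,
          ← intervalIntegral.integral_const_mul]
        · refine intervalIntegral.integral_congr fun t _ => ?_
          rw [intervalIntegral.integral_mul_const, ← mul_assoc, hK1, one_mul]
        · have : Continuous (Function.uncurry fun s t => K s t * F t) := hKF
          have hc := (isCompact_uIcc (a := (0 : ℝ)) (b := 2 * Real.pi)).prod
            (isCompact_uIcc (a := (0 : ℝ)) (b := 2 * Real.pi))
          exact (this.continuousOn.integrableOn_compact hc).mono_set
            (Set.prod_mono uIoc_subset_uIcc uIoc_subset_uIcc)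
    _ = circleMeanSq f 1 := rfl

/-- The normalized Blaschke factor with zero `a`. -/
def blaschkeFactor (a z : ℂ) : ℂ :=
  ((‖a‖ : ℂ) / a) * ((a - z) / (1 - (starRingEnd ℂ) a * z))

lemma one_sub_conj_mul_ne_zero {a z : ℂ} (ha : ‖a‖ < 1) (hz : z ∈ closedBall (0 : ℂ) 1) :
    1 - (starRingEnd ℂ) a * z ≠ 0 := by
  intro h
  rw [mem_closedBall_zero_iff] at hz
  have h1 : (starRingEnd ℂ) a * z = 1 := (sub_eq_zero.1 h).symm
  have h2 : ‖a‖ * ‖z‖ = 1 := by simpa using congrArg norm h1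
  nlinarith [norm_nonneg a, norm_nonneg z]

lemma norm_sq_one_sub_conj_mul (a z : ℂ) :
    ‖1 - (starRingEnd ℂ) a * z‖ ^ 2 = ‖a - z‖ ^ 2 + (1 - ‖a‖ ^ 2) * (1 - ‖z‖ ^ 2) := by
  simp only [← Complex.normSq_eq_norm_sq, Complex.normSq_sub, map_mul, map_one,
    Complex.normSq_conj, Complex.conj_conj, one_mul]
  ring

lemma norm_unimodular_div {a : ℂ} (ha0 : a ≠ 0) : ‖(‖a‖ : ℂ) / a‖ = 1 := by
  simp [ha0]

lemma norm_sq_blaschkeFactor {a z : ℂ} (ha : ‖a‖ < 1) (ha0 : a ≠ 0)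
    (hz : z ∈ closedBall (0 : ℂ) 1) :
    1 - ‖blaschkeFactor a z‖ ^ 2 =
      (1 - ‖a‖ ^ 2) * (1 - ‖z‖ ^ 2) / ‖1 - (starRingEnd ℂ) a * z‖ ^ 2 := by
  have h := norm_sq_one_sub_conj_mul a z
  have h0 : ‖1 - (starRingEnd ℂ) a * z‖ ^ 2 ≠ 0 :=
    pow_ne_zero _ (norm_ne_zero_iff.2 (one_sub_conj_mul_ne_zero ha hz))
  rw [blaschkeFactor, norm_mul, norm_unimodular_div ha0, one_mul, norm_div, div_pow]
  rw [eq_div_iff h0, sub_mul, div_mul_cancel₀ _ h0, h]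
  ring

lemma isInner_blaschkeFactor {a : ℂ} (ha : ‖a‖ < 1) (ha0 : a ≠ 0) :
    IsInner (blaschkeFactor a) := by
  constructor
  · intro z hz
    exact analyticAt_const.fun_mul ((analyticAt_const.fun_sub analyticAt_id).fun_div
      (analyticAt_const.fun_sub (analyticAt_const.fun_mul analyticAt_id))
      (one_sub_conj_mul_ne_zero ha hz))
  · intro z hz
    have h := norm_sq_blaschkeFactor ha ha0 (sphere_subset_closedBall hz)
    rw [mem_sphere_zero_iff_norm.1 hz] at h
    have : ‖blaschkeFactor a z‖ ^ 2 = 1 := by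
      simp at h
      linarith
    exact (pow_eq_one_iff_of_nonneg (norm_nonneg _) two_ne_zero).1 this

lemma norm_blaschkeFactor_le_one {a z : ℂ} (ha : ‖a‖ < 1) (ha0 : a ≠ 0)
    (hz : z ∈ closedBall (0 : ℂ) 1) : ‖blaschkeFactor a z‖ ≤ 1 := by
  have h := norm_sq_blaschkeFactor ha ha0 hz
  rw [mem_closedBall_zero_iff] at hz
  have h1 : ‖z‖ ^ 2 ≤ 1 := pow_le_one₀ (norm_nonneg _) hz
  have h2 : ‖a‖ ^ 2 ≤ 1 := pow_le_one₀ (norm_nonneg _) ha.le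
  have h3 : 0 ≤ 1 - ‖blaschkeFactor a z‖ ^ 2 := by
    rw [h]
    exact div_nonneg (mul_nonneg (by linarith) (by linarith)) (by positivity)
  nlinarith [norm_nonneg (blaschkeFactor a z)]

lemma iterSlope_blaschkeFactor {a : ℂ} (ha : ‖a‖ < 1) (k : ℕ) :
    EqOn (iterSlope (k + 1) (blaschkeFactor a))
      (fun z => -((‖a‖ : ℂ) / a * (1 - (‖a‖ : ℂ) ^ 2) * (starRingEnd ℂ) a ^ k /
        (1 - (starRingEnd ℂ) a) ^ (k + 1)) * (1 - (starRingEnd ℂ) a * z)⁻¹)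
      {z | 1 - (starRingEnd ℂ) a * z ≠ 0} := by
  have hU : IsOpen {z : ℂ | 1 - (starRingEnd ℂ) a * z ≠ 0} :=
    isOpen_ne_fun (by fun_prop) continuous_const
  have h1 : 1 - (starRingEnd ℂ) a * 1 ≠ 0 := one_sub_conj_mul_ne_zero ha one_mem_closedBall
  have h1' : 1 - (starRingEnd ℂ) a ≠ 0 := by simpa using h1
  have key : ∀ c z : ℂ, 1 - (starRingEnd ℂ) a * z ≠ 0 →
      dslope (fun z => c * (1 - (starRingEnd ℂ) a * z)⁻¹) 1 z =
        c * ((starRingEnd ℂ) a / (1 - (starRingEnd ℂ) a)) * (1 - (starRingEnd ℂ) a * z)⁻¹ := by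
    intro c z hz
    rcases eq_or_ne z 1 with rfl | hne
    · rw [dslope_same]
      have : HasDerivAt (fun z => 1 - (starRingEnd ℂ) a * z) (-(starRingEnd ℂ) a) 1 := by
        simpa using ((hasDerivAt_id (1 : ℂ)).const_mul ((starRingEnd ℂ) a)).const_sub 1
      rw [((this.fun_inv hz).const_mul c).deriv]
      simp only [mul_one]
      field_simp
    · rw [dslope_one_of_ne _ hne]
      have := sub_ne_zero.2 hne
      rw [mul_one]
      field_simp
      ring
  have hnorm : (‖a‖ : ℂ) ^ 2 = a * (starRingEnd ℂ) a := (Complex.mul_conj' a).symm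
  induction k with
  | zero =>
    intro z hz
    have hz' : 1 - (starRingEnd ℂ) a * z ≠ 0 := hz
    rw [iterSlope_succ, iterSlope_zero]
    have e : EqOn (blaschkeFactor a) (fun z => blaschkeFactor a 1 + (1 - z) *
        ((‖a‖ : ℂ) / a * (1 - (‖a‖ : ℂ) ^ 2) / (1 - (starRingEnd ℂ) a) *
          (1 - (starRingEnd ℂ) a * z)⁻¹)) {z | 1 - (starRingEnd ℂ) a * z ≠ 0} := by
      intro z hz
      have hz' : 1 - (starRingEnd ℂ) a * z ≠ 0 := hz
      simp only [blaschkeFactor]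
      rw [hnorm, mul_one]
      have hz2 : 1 - z * (starRingEnd ℂ) a ≠ 0 := by rwa [mul_comm z]
      generalize (‖a‖ : ℂ) / a = u
      generalize (starRingEnd ℂ) a = c at *
      field_simp
      ring
    rcases eq_or_ne z 1 with rfl | hne
    · rw [dslope_same, (e.eventuallyEq_of_mem (hU.mem_nhds h1)).deriv_eq]
      set φ : ℂ → ℂ := fun z => (‖a‖ : ℂ) / a * (1 - (‖a‖ : ℂ) ^ 2) / (1 - (starRingEnd ℂ) a) *
          (1 - (starRingEnd ℂ) a * z)⁻¹ with hφ
      have hd : DifferentiableAt ℂ φ 1 := by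
        have : DifferentiableAt ℂ (fun z => 1 - (starRingEnd ℂ) a * z) 1 := by fun_prop
        exact (this.fun_inv h1).const_mul _
      have hs : HasDerivAt (fun z : ℂ => 1 - z) (-1) 1 := (hasDerivAt_id (1 : ℂ)).const_sub 1
      rw [((hs.fun_mul hd.hasDerivAt).const_add (blaschkeFactor a 1)).deriv]
      simp [hφ]
    · rw [dslope_one_of_ne _ hne, e hz]
      have := sub_ne_zero.2 hne
      simp only [pow_zero, mul_one, zero_add, pow_one]
      rw [add_sub_cancel_left, div_eq_iff this]
      ring
  | succ k ih =>
    intro z hz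
    rw [iterSlope_succ, dslope_one_congr hU h1 ih hz, key _ z hz]
    simp only
    congr 1
    field_simp
    ring

lemma norm_one_sub_conj (a : ℂ) : ‖1 - (starRingEnd ℂ) a‖ = ‖1 - a‖ := by
  rw [← Complex.norm_conj, map_sub, map_one, Complex.conj_conj]

lemma norm_iterSlope_blaschkeFactor {a z : ℂ} (ha : ‖a‖ < 1) (ha0 : a ≠ 0)
    (hz : z ∈ closedBall (0 : ℂ) 1) (k : ℕ) :
    ‖iterSlope (k + 1) (blaschkeFactor a) z‖ ≤
      (1 - ‖a‖ ^ 2) / ‖1 - a‖ ^ (k + 1) * ‖1 - (starRingEnd ℂ) a * z‖⁻¹ := by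
  rw [iterSlope_blaschkeFactor ha k (one_sub_conj_mul_ne_zero ha hz)]
  have h2 : ‖a‖ ^ 2 ≤ 1 := pow_le_one₀ (norm_nonneg _) ha.le
  have h3 : ‖1 - (‖a‖ : ℂ) ^ 2‖ = 1 - ‖a‖ ^ 2 := by
    rw [← Complex.ofReal_pow, ← Complex.ofReal_one, ← Complex.ofReal_sub, Complex.norm_real,
      Real.norm_of_nonneg (by linarith)]
  rw [norm_mul, norm_neg, norm_div, norm_mul, norm_mul, norm_unimodular_div ha0, h3, norm_pow,
    norm_pow, norm_inv, norm_one_sub_conj, RCLike.norm_conj, one_mul]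
  gcongr
  exact mul_le_of_le_one_right (by linarith) (pow_le_one₀ (norm_nonneg _) ha.le)

lemma norm_iterSlope_blaschkeFactor_one {a : ℂ} (ha : ‖a‖ < 1) (ha0 : a ≠ 0) (k : ℕ) :
    ‖iterSlope (k + 1) (blaschkeFactor a) 1‖ ≤ (1 - ‖a‖ ^ 2) / ‖1 - a‖ ^ (k + 2) := by
  refine (norm_iterSlope_blaschkeFactor ha ha0 one_mem_closedBall k).trans_eq ?_
  rw [mul_one, norm_one_sub_conj, pow_succ _ (k + 1), ← div_eq_mul_inv, div_div]

lemma circleMeanSq_iterSlope_blaschkeFactor {a : ℂ} (ha : ‖a‖ < 1) (ha0 : a ≠ 0) (k : ℕ) :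
    circleMeanSq (iterSlope (k + 1) (blaschkeFactor a)) 1 ≤
      (1 - ‖a‖ ^ 2) / ‖1 - a‖ ^ (2 * (k + 1)) := by
  have hab : a ∈ ball (0 : ℂ) 1 := by simpa using ha
  have h2 : 0 < 1 - ‖a‖ ^ 2 := by nlinarith [norm_nonneg a]
  have hP := circleAverage_poissonKernel hab
  have hPc := continuousOn_poissonKernel_sphere hab
  set C := (1 - ‖a‖ ^ 2) / ‖1 - a‖ ^ (2 * (k + 1)) with hC
  calc circleMeanSq (iterSlope (k + 1) (blaschkeFactor a)) 1
      ≤ Real.circleAverage (fun z => C • poissonKernel 0 a z) 0 1 := by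
        refine Real.circleAverage_mono ?_ ?_ fun z hz => ?_
        · exact (((isInner_blaschkeFactor ha ha0).analytic.iterSlope
            (k + 1)).continuousOn_sphere).circleIntegrable_normSq
        · exact (hPc.const_smul C).circleIntegrable zero_le_one
        · have hz' : z ∈ sphere (0 : ℂ) 1 := by simpa using hz
          have hzn := mem_sphere_zero_iff_norm.1 hz'
          have h := norm_iterSlope_blaschkeFactor ha ha0 (sphere_subset_closedBall hz') k
          have hn := norm_sq_one_sub_conj_mul a z
          rw [hzn] at hn
          have hza : ‖z - a‖ ^ 2 = ‖1 - (starRingEnd ℂ) a * z‖ ^ 2 := by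
            rw [hn, norm_sub_rev]
            ring
          calc ‖iterSlope (k + 1) (blaschkeFactor a) z‖ ^ 2
              ≤ ((1 - ‖a‖ ^ 2) / ‖1 - a‖ ^ (k + 1) * ‖1 - (starRingEnd ℂ) a * z‖⁻¹) ^ 2 := by
                gcongr
            _ = C • poissonKernel 0 a z := by
                rw [hC, poissonKernel, sub_zero, sub_zero, hzn, hza, smul_eq_mul, mul_pow, div_pow,
                  inv_pow, mul_comm 2 (k + 1), pow_mul]
                ring
    _ = C := by rw [Real.circleAverage_fun_smul, hP, smul_eq_mul, mul_one]

lemma exists_forall_le_of_succ_le {y δ ε : ℕ → ℝ} (hy : 0 ≤ y 0) (hδ : ∀ n, 0 ≤ δ n)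
    (hε : ∀ n, 0 ≤ ε n) (hδs : Summable δ) (hεs : Summable ε)
    (h : ∀ n, y (n + 1) ≤ (1 + δ n) * y n + ε n) : ∃ C, 0 ≤ C ∧ ∀ n, y n ≤ C := by
  have key : ∀ n, y n ≤ (y 0 + ∑ k ∈ Finset.range n, ε k) *
      Real.exp (∑ k ∈ Finset.range n, δ k) := by
    intro n
    induction n with
    | zero => simp
    | succ n ih =>
      set D := ∑ k ∈ Finset.range n, δ k with hD
      set E := ∑ k ∈ Finset.range n, ε k with hE
      have hE0 : 0 ≤ E := Finset.sum_nonneg fun k _ => hε k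
      have hD0 : 0 ≤ D := Finset.sum_nonneg fun k _ => hδ k
      rw [Finset.sum_range_succ, Finset.sum_range_succ, ← hD, ← hE]
      have h1 : 1 + δ n ≤ Real.exp (δ n) := by linarith [Real.add_one_le_exp (δ n)]
      have h2 : 1 ≤ Real.exp (D + δ n) := Real.one_le_exp (add_nonneg hD0 (hδ n))
      calc y (n + 1) ≤ (1 + δ n) * y n + ε n := h n
        _ ≤ (1 + δ n) * ((y 0 + E) * Real.exp D) + ε n := by
          have := hδ n
          gcongr
        _ ≤ Real.exp (δ n) * ((y 0 + E) * Real.exp D) + ε n * Real.exp (D + δ n) := by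
          gcongr
          exact le_mul_of_one_le_right (hε n) h2
        _ = (y 0 + (E + ε n)) * Real.exp (D + δ n) := by
          rw [Real.exp_add]
          ring
  refine ⟨(y 0 + ∑' k, ε k) * Real.exp (∑' k, δ k), ?_, fun n => (key n).trans ?_⟩
  · exact mul_nonneg (add_nonneg hy (tsum_nonneg hε)) (Real.exp_pos _).le
  · have h1 := hεs.sum_le_tsum (Finset.range n) fun k _ => hε k
    have h2 := hδs.sum_le_tsum (Finset.range n) fun k _ => hδ k
    have h3 : 0 ≤ ∑' k, ε k := tsum_nonneg hε
    gcongr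

/-- The partial products of a sequence of functions. -/
def partialProd (b : ℕ → ℂ → ℂ) (n : ℕ) (z : ℂ) : ℂ := ∏ k ∈ Finset.range n, b k z

lemma partialProd_zero (b : ℕ → ℂ → ℂ) : partialProd b 0 = fun _ => 1 := by
  ext z
  simp [partialProd]

lemma partialProd_succ (b : ℕ → ℂ → ℂ) (n : ℕ) :
    partialProd b (n + 1) = fun z => partialProd b n z * b n z := by
  ext z
  simp [partialProd, Finset.prod_range_succ]

lemma isInner_partialProd {b : ℕ → ℂ → ℂ} (hb : ∀ n, IsInner (b n)) (n : ℕ) :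
    IsInner (partialProd b n) := by
  induction n with
  | zero =>
    rw [partialProd_zero]
    exact isInner_one
  | succ n ih =>
    rw [partialProd_succ]
    exact ih.mul (hb n)

lemma IsInner.norm_at_one {f : ℂ → ℂ} (hf : IsInner f) : ‖f 1‖ = 1 :=
  hf.norm_eq 1 (by simp)

lemma exists_norm_iterSlope_partialProd_le {b : ℕ → ℂ → ℂ} (hb : ∀ n, IsInner (b n))
    {t : ℕ → ℝ} (ht0 : ∀ n, 0 ≤ t n) (ht : Summable t) {N : ℕ}
    (h : ∀ n j, j + 1 < N → ‖iterSlope (j + 1) (b n) 1‖ ≤ t n) (k : ℕ) :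
    k < N → ∃ C, 0 ≤ C ∧ ∀ n, ‖iterSlope k (partialProd b n) 1‖ ≤ C := by
  induction k using Nat.strong_induction_on with
  | _ k ih =>
  intro hk
  cases k with
  | zero => exact ⟨1, zero_le_one, fun n => (isInner_partialProd hb n).norm_at_one.le⟩
  | succ m =>
    have ih' : ∀ j, ∃ C, 0 ≤ C ∧ (j < m + 1 → ∀ n, ‖iterSlope j (partialProd b n) 1‖ ≤ C) := by
      intro j
      by_cases hj : j < m + 1
      · obtain ⟨C, hC, hC'⟩ := ih j hj (hj.trans hk)
        exact ⟨C, hC, fun _ => hC'⟩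
      · exact ⟨0, le_rfl, fun h => absurd h hj⟩
    choose C hC0 hC using ih'
    set K := ∑ j ∈ Finset.range m, C (m - j) with hK
    have hK0 : 0 ≤ K := Finset.sum_nonneg fun j _ => hC0 _
    refine exists_forall_le_of_succ_le (δ := fun _ => 0) (ε := fun n => t n * (1 + K))
      (norm_nonneg _) (fun _ => le_rfl) (fun n => mul_nonneg (ht0 n) (by linarith))
      summable_zero (ht.mul_right _) fun n => ?_
    have hP := isInner_partialProd hb n
    rw [partialProd_succ, iterSlope_mul (hP.analytic 1 one_mem_closedBall)
      ((hb n).analytic 1 one_mem_closedBall)]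
    simp only [Finset.sum_range_succ', Nat.add_sub_add_right, Nat.sub_zero, iterSlope_zero, add_zero, one_mul]
    have h1 : ‖∑ j ∈ Finset.range m, iterSlope (j + 1) (b n) 1 *
        iterSlope (m - j) (partialProd b n) 1‖ ≤ t n * K := by
      rw [hK, Finset.mul_sum]
      refine norm_sum_le_of_le _ fun j hj => ?_
      have hj := Finset.mem_range.1 hj
      rw [norm_mul]
      exact mul_le_mul (h n j (by omega)) (hC _ (by omega) n) (norm_nonneg _) (ht0 n)
    have h2 := h n m hk
    refine (norm_add_le _ _).trans ?_
    refine (add_le_add_right (norm_add_le _ _) _).trans ?_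
    rw [norm_mul, norm_mul, hP.norm_at_one, (hb n).norm_at_one]
    linarith

lemma norm_add_sum_sq_le {ι : Type*} (s : Finset ι) (u : ℂ) (a v : ι → ℂ) :
    ‖∑ i ∈ s, a i * v i + u‖ ^ 2 ≤
      (1 + ∑ i ∈ s, ‖a i‖) * (‖u‖ ^ 2 + ∑ i ∈ s, ‖a i‖ * ‖v i‖ ^ 2) := by
  have hT : ‖∑ i ∈ s, a i * v i + u‖ ≤ ∑ i ∈ s, ‖a i‖ * ‖v i‖ + ‖u‖ :=
    (norm_add_le _ _).trans (by
      gcongr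
      exact norm_sum_le_of_le _ fun i _ => (norm_mul _ _).le)
  have hCS : (∑ i ∈ s, ‖a i‖ * ‖v i‖) ^ 2 ≤ (∑ i ∈ s, ‖a i‖) * ∑ i ∈ s, ‖a i‖ * ‖v i‖ ^ 2 :=
    Finset.sum_sq_le_sum_mul_sum_of_sq_le_mul s (fun i _ => norm_nonneg _)
      (fun i _ => by positivity) fun i _ => le_of_eq (by ring)
  refine (pow_le_pow_left₀ (norm_nonneg _) hT 2).trans ?_
  have hS0 : 0 ≤ ∑ i ∈ s, ‖a i‖ := Finset.sum_nonneg fun i _ => norm_nonneg _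
  have hT0 : 0 ≤ ∑ i ∈ s, ‖a i‖ * ‖v i‖ := Finset.sum_nonneg fun i _ => by positivity
  have hQ0 : 0 ≤ ∑ i ∈ s, ‖a i‖ * ‖v i‖ ^ 2 := Finset.sum_nonneg fun i _ => by positivity
  generalize ∑ i ∈ s, ‖a i‖ = S at *
  generalize ∑ i ∈ s, ‖a i‖ * ‖v i‖ = T at *
  generalize ∑ i ∈ s, ‖a i‖ * ‖v i‖ ^ 2 = Q at *
  have hx := norm_nonneg u
  have h2 : 2 * (‖u‖ * T) ≤ Q + S * ‖u‖ ^ 2 := by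
    refine abs_le_of_sq_le_sq' ?_ (by positivity) |>.2
    nlinarith [sq_nonneg (Q - S * ‖u‖ ^ 2), mul_le_mul_of_nonneg_left hCS (sq_nonneg ‖u‖)]
  nlinarith

lemma circleMeanSq_add_sum_le {ι : Type*} (s : Finset ι) {u : ℂ → ℂ} (a : ι → ℂ) {v : ι → ℂ → ℂ}
    (hu : ContinuousOn u (sphere (0 : ℂ) 1)) (hv : ∀ i, ContinuousOn (v i) (sphere (0 : ℂ) 1)) :
    circleMeanSq (fun z => ∑ i ∈ s, a i * v i z + u z) 1 ≤
      (1 + ∑ i ∈ s, ‖a i‖) * (circleMeanSq u 1 + ∑ i ∈ s, ‖a i‖ * circleMeanSq (v i) 1) := by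
  have hi : ∀ i, CircleIntegrable (fun z => ‖a i‖ • ‖v i z‖ ^ 2) 0 1 := fun i =>
    (((hv i).norm.pow 2).const_smul ‖a i‖).circleIntegrable zero_le_one
  have hsumc : ContinuousOn (fun z => ∑ i ∈ s, ‖a i‖ • ‖v i z‖ ^ 2) (sphere (0 : ℂ) 1) :=
    continuousOn_finsetSum _ fun i _ => ((hv i).norm.pow 2).const_smul ‖a i‖
  have hun : ContinuousOn (fun z => ‖u z‖ ^ 2) (sphere (0 : ℂ) 1) := hu.norm.pow 2
  have hlhs : ContinuousOn (fun z => ∑ i ∈ s, a i * v i z + u z) (sphere (0 : ℂ) 1) :=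
    (continuousOn_finsetSum _ fun i _ => continuousOn_const.mul (hv i)).add hu
  have hrhs : ContinuousOn (fun z => (1 + ∑ i ∈ s, ‖a i‖) •
      (‖u z‖ ^ 2 + ∑ i ∈ s, ‖a i‖ • ‖v i z‖ ^ 2)) (sphere (0 : ℂ) 1) :=
    (hun.add hsumc).const_smul (1 + ∑ i ∈ s, ‖a i‖)
  calc circleMeanSq (fun z => ∑ i ∈ s, a i * v i z + u z) 1
      ≤ Real.circleAverage (fun z => (1 + ∑ i ∈ s, ‖a i‖) •
        (‖u z‖ ^ 2 + ∑ i ∈ s, ‖a i‖ • ‖v i z‖ ^ 2)) 0 1 :=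
        Real.circleAverage_mono hlhs.circleIntegrable_normSq (hrhs.circleIntegrable zero_le_one)
          fun z _ => norm_add_sum_sq_le s (u z) a fun i => v i z
    _ = _ := by
        rw [Real.circleAverage_fun_smul, Real.circleAverage_fun_add
          (hun.circleIntegrable zero_le_one) (hsumc.circleIntegrable zero_le_one),
          Real.circleAverage_fun_sum fun i _ => hi i]
        simp_rw [Real.circleAverage_fun_smul]
        rfl

lemma exists_circleMeanSq_iterSlope_partialProd_le {b : ℕ → ℂ → ℂ} (hb : ∀ n, IsInner (b n))
    {t : ℕ → ℝ} (ht0 : ∀ n, 0 ≤ t n) (ht : Summable t) {N : ℕ}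
    (h : ∀ n j, j + 1 < N → ‖iterSlope (j + 1) (b n) 1‖ ≤ t n)
    (h2 : ∀ n j, j < N → circleMeanSq (iterSlope (j + 1) (b n)) 1 ≤ t n) (k : ℕ) :
    k < N → ∃ C, 0 ≤ C ∧ ∀ n, circleMeanSq (iterSlope (k + 1) (partialProd b n)) 1 ≤ C := by
  induction k using Nat.strong_induction_on with
  | _ m ih =>
  intro hm
  have ih' : ∀ j, ∃ C, 0 ≤ C ∧
      (j < m → ∀ n, circleMeanSq (iterSlope (j + 1) (partialProd b n)) 1 ≤ C) := by
    intro j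
    by_cases hj : j < m
    · obtain ⟨C, hC, hC'⟩ := ih j hj (hj.trans hm)
      exact ⟨C, hC, fun _ => hC'⟩
    · exact ⟨0, le_rfl, fun h => absurd h hj⟩
  choose C hC0 hC using ih'
  set K := ∑ j ∈ Finset.range m, C (m - j - 1) with hK
  have hK0 : 0 ≤ K := Finset.sum_nonneg fun j _ => hC0 _
  set T := ∑' n, t n with hT
  have hT0 : 0 ≤ T := tsum_nonneg ht0
  have hc : 0 ≤ 1 + (1 + m * T) * K := by positivity
  refine exists_forall_le_of_succ_le (δ := fun n => m * t n)
    (ε := fun n => t n * (1 + (1 + m * T) * K))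
    (circleMeanSq_nonneg _ _) (fun n => mul_nonneg (Nat.cast_nonneg _) (ht0 n))
    (fun n => mul_nonneg (ht0 n) hc) (ht.mul_left _) (ht.mul_right _) fun n => ?_
  have hP := isInner_partialProd hb n
  have htT : t n ≤ T := ht.le_tsum n fun k _ => ht0 k
  rw [partialProd_succ, iterSlope_mul (hP.analytic 1 one_mem_closedBall)
    ((hb n).analytic 1 one_mem_closedBall), hP.circleMeanSq_mul_add
    ((hb n).analytic.iterSlope (m + 1)) (m + 1) fun j => iterSlope j (b n) 1]
  simp only [Finset.sum_range_succ', Nat.add_sub_add_right, Nat.sub_zero, iterSlope_zero]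
  have hv : ∀ i, ContinuousOn (iterSlope i (partialProd b n)) (sphere (0 : ℂ) 1) := fun i =>
    (hP.analytic.iterSlope i).continuousOn_sphere
  have hu : ContinuousOn (fun z => b n 1 * iterSlope (m + 1) (partialProd b n) z)
      (sphere (0 : ℂ) 1) := continuousOn_const.mul (hv _)
  have hmain := circleMeanSq_add_sum_le (Finset.range m)
    (fun j => iterSlope (j + 1) (b n) 1) (v := fun j => iterSlope (m - j) (partialProd b n)) hu
    fun j => hv _
  have hum : circleMeanSq (fun z => b n 1 * iterSlope (m + 1) (partialProd b n) z) 1 =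
      circleMeanSq (iterSlope (m + 1) (partialProd b n)) 1 :=
    circleMeanSq_congr fun z _ => by rw [norm_mul, (hb n).norm_at_one, one_mul]
  rw [hum] at hmain
  have hS : ∑ j ∈ Finset.range m, ‖iterSlope (j + 1) (b n) 1‖ ≤ m * t n := by
    refine (Finset.sum_le_card_nsmul _ _ (t n) fun j hj => h n j ?_).trans_eq (by simp)
    have := Finset.mem_range.1 hj
    omega
  have hQ : ∑ j ∈ Finset.range m, ‖iterSlope (j + 1) (b n) 1‖ *
      circleMeanSq (iterSlope (m - j) (partialProd b n)) 1 ≤ t n * K := by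
    rw [hK, Finset.mul_sum]
    refine Finset.sum_le_sum fun j hj => ?_
    have hj := Finset.mem_range.1 hj
    have e : m - j = (m - j - 1) + 1 := by omega
    refine mul_le_mul (h n j (by omega)) ?_ (circleMeanSq_nonneg _ _) (ht0 n)
    rw [e]
    exact hC _ (by omega) n
  have hx := circleMeanSq_nonneg (iterSlope (m + 1) (partialProd b n)) 1
  have htn := ht0 n
  have hQ0 : 0 ≤ ∑ j ∈ Finset.range m, ‖iterSlope (j + 1) (b n) 1‖ *
      circleMeanSq (iterSlope (m - j) (partialProd b n)) 1 :=
    Finset.sum_nonneg fun j _ => mul_nonneg (norm_nonneg _) (circleMeanSq_nonneg _ _)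
  have hle := hmain.trans (mul_le_mul (add_le_add_right hS 1) (add_le_add_right hQ _)
    (add_nonneg hx hQ0) (by positivity))
  calc _ ≤ t n + (1 + m * t n) *
        (circleMeanSq (iterSlope (m + 1) (partialProd b n)) 1 + t n * K) := by
        exact add_le_add (h2 n m hm) hle
    _ ≤ t n + ((1 + m * t n) * circleMeanSq (iterSlope (m + 1) (partialProd b n)) 1 +
        (1 + m * T) * (t n * K)) := by
        rw [mul_add]
        gcongr
    _ = _ := by ring

lemma differentiableOn_of_tendsto_of_norm_le_one {P : ℕ → ℂ → ℂ} {B : ℂ → ℂ}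
    (hP : ∀ n, AnalyticOnNhd ℂ (P n) (closedBall 0 1))
    (hle : ∀ n, ∀ z ∈ closedBall (0 : ℂ) 1, ‖P n z‖ ≤ 1)
    (hlim : ∀ z ∈ ball (0 : ℂ) 1, Tendsto (fun n => P n z) atTop (𝓝 (B z))) :
    DifferentiableOn ℂ B (ball 0 1) := by
  intro w hw
  obtain ⟨ρ, hwρ, hρ1⟩ := exists_between (mem_ball_zero_iff.1 hw)
  have hρ0 : 0 < ρ := (norm_nonneg w).trans_lt hwρ
  lift ρ to ℝ≥0 using hρ0.le
  have hγ : ∀ θ, circleMap 0 ρ θ ∈ ball (0 : ℂ) 1 := fun θ => by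
    rw [mem_ball_zero_iff, norm_circleMap_zero, abs_of_pos hρ0]
    exact hρ1
  have hγ' : ∀ θ, circleMap 0 ρ θ ∈ closedBall (0 : ℂ) 1 := fun θ => ball_subset_closedBall (hγ θ)
  have hPc : ∀ n, Continuous fun θ => P n (circleMap 0 ρ θ) := fun n =>
    (hP n).continuousOn.comp_continuous (continuous_circleMap 0 ρ) hγ'
  have hmeas : AEStronglyMeasurable (fun θ => B (circleMap 0 ρ θ)) volume :=
    aestronglyMeasurable_of_tendsto_ae atTop (fun n => (hPc n).aestronglyMeasurable)
      (ae_of_all _ fun θ => hlim _ (hγ θ))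
  have hBle : ∀ θ, ‖B (circleMap 0 ρ θ)‖ ≤ 1 := fun θ =>
    le_of_tendsto' (hlim _ (hγ θ)).norm fun n => hle n _ (hγ' θ)
  have hint : CircleIntegrable B 0 ρ :=
    (intervalIntegrable_const (c := (1 : ℝ))).mono_fun hmeas.restrict
      (ae_of_all _ fun θ => by simpa using hBle θ)
  have hform : EqOn B (fun v => (2 * Real.pi * I : ℂ)⁻¹ • ∮ z in C(0, ρ), (z - v)⁻¹ • B z)
      (ball 0 ρ) := by
    intro v hv
    have hv1 : v ∈ ball (0 : ℂ) 1 := ball_subset_ball hρ1.le hv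
    have hsub : closedBall (0 : ℂ) ρ ⊆ closedBall 0 1 := closedBall_subset_closedBall hρ1.le
    have hcauchy : ∀ n, (2 * Real.pi * I : ℂ)⁻¹ • ∮ z in C(0, ρ), (z - v)⁻¹ • P n z = P n v :=
      fun n => DiffContOnCl.two_pi_i_inv_smul_circleIntegral_sub_inv_smul
        (DifferentiableOn.diffContOnCl (((hP n).differentiableOn).mono
          (by rwa [closure_ball _ hρ0.ne']))) hv
    have hne : ∀ θ, circleMap 0 ρ θ - v ≠ 0 := fun θ => by
      refine sub_ne_zero.2 (circleMap_ne_mem_ball hv θ)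
    have hkc : Continuous fun θ => (circleMap 0 ρ θ - v)⁻¹ :=
      ((continuous_circleMap 0 ρ).sub continuous_const).inv₀ hne
    have hdc : Continuous fun θ => deriv (circleMap 0 ρ) θ := by
      simp only [deriv_circleMap]
      fun_prop
    refine tendsto_nhds_unique (hlim v hv1) ?_
    have : Tendsto (fun n => ∮ z in C(0, ρ), (z - v)⁻¹ • P n z) atTop
        (𝓝 (∮ z in C(0, ρ), (z - v)⁻¹ • B z)) := by
      refine intervalIntegral.tendsto_integral_filter_of_dominated_convergence
        (fun θ => ‖deriv (circleMap 0 ρ) θ‖ * ‖(circleMap 0 ρ θ - v)⁻¹‖) ?_ ?_ ?_ ?_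
      · exact Eventually.of_forall fun n => (hdc.smul (hkc.smul (hPc n))).aestronglyMeasurable
      · refine Eventually.of_forall fun n => ae_of_all _ fun θ _ => ?_
        rw [norm_smul, norm_smul]
        gcongr
        exact mul_le_of_le_one_right (norm_nonneg _) (hle n _ (hγ' θ))
      · exact (hdc.norm.mul hkc.norm).intervalIntegrable _ _
      · exact ae_of_all _ fun θ _ => ((hlim _ (hγ θ)).const_smul _).const_smul _
    simpa only [hcauchy] using this.const_smul (2 * Real.pi * I : ℂ)⁻¹
  have han := hasFPowerSeriesOn_cauchy_integral hint hρ0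
  have hwb : w ∈ ball (0 : ℂ) ρ := mem_ball_zero_iff.2 hwρ
  have hd := han.differentiableOn w (by simpa using hwb)
  rw [Metric.eball_coe] at hd
  exact ((hd.differentiableAt (isOpen_ball.mem_nhds hwb)).congr_of_eventuallyEq
    (hform.eventuallyEq_of_mem (isOpen_ball.mem_nhds hwb))).differentiableWithinAt

lemma circleMeanSq_le_of_tendsto {F : ℕ → ℂ → ℂ} {g : ℂ → ℂ}
    (hF : ∀ n, AnalyticOnNhd ℂ (F n) (closedBall 0 1)) {C M r : ℝ} (hr0 : 0 < r) (hr1 : r < 1)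
    (hC : ∀ n, circleMeanSq (F n) 1 ≤ C) (hM : ∀ n, ∀ z ∈ sphere (0 : ℂ) r, ‖F n z‖ ≤ M)
    (hlim : ∀ z ∈ sphere (0 : ℂ) r, Tendsto (fun n => F n z) atTop (𝓝 (g z))) :
    circleMeanSq g r ≤ C := by
  have hγ : ∀ θ, circleMap 0 r θ ∈ sphere (0 : ℂ) r := fun θ => circleMap_mem_sphere _ hr0.le _
  have hFc : ∀ n, Continuous fun θ => F n (circleMap 0 r θ) := fun n =>
    (hF n).continuousOn.comp_continuous (continuous_circleMap 0 r) fun θ =>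
      closedBall_subset_closedBall hr1.le (sphere_subset_closedBall (hγ θ))
  have h : Tendsto (fun n => circleMeanSq (F n) r) atTop (𝓝 (circleMeanSq g r)) := by
    simp only [circleMeanSq, Real.circleAverage_def]
    refine Tendsto.const_smul ?_ _
    refine intervalIntegral.tendsto_integral_filter_of_dominated_convergence
      (fun _ => M ^ 2) ?_ ?_ intervalIntegrable_const ?_
    · exact Eventually.of_forall fun n => ((hFc n).norm.pow 2).aestronglyMeasurable
    · refine Eventually.of_forall fun n => ae_of_all _ fun θ _ => ?_
      rw [Real.norm_of_nonneg (by positivity)]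
      exact pow_le_pow_left₀ (norm_nonneg _) (hM n _ (hγ θ)) 2
    · exact ae_of_all _ fun θ _ => (hlim _ (hγ θ)).norm.pow 2
  exact le_of_tendsto' h fun n => ((hF n).circleMeanSq_le hr0 hr1).trans (hC n)

lemma memHardy2_of_circleMeanSq_le {g : ℂ → ℂ} (hg : DifferentiableOn ℂ g (ball 0 1)) {C : ℝ}
    (h : ∀ r, 0 < r → r < 1 → circleMeanSq g r ≤ C) : MemHardy2 g := by
  refine ⟨hg, C, fun r hr0 hr1 => ?_⟩
  have := h r hr0 hr1
  simpa [circleMeanSq, Real.circleAverage_def, circleMap] using this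

lemma one_sub_le_norm_sub_one {r : ℝ} {z : ℂ} (hz : ‖z‖ ≤ r) : 1 - r ≤ ‖z - 1‖ := by
  have := norm_sub_norm_le (1 : ℂ) z
  rw [norm_one, norm_sub_rev] at this
  linarith

lemma exists_memHardy2_of_tendsto {P : ℕ → ℂ → ℂ} {B : ℂ → ℂ} {N : ℕ}
    (hP : ∀ n, AnalyticOnNhd ℂ (P n) (closedBall 0 1))
    (hle : ∀ n, ∀ z ∈ closedBall (0 : ℂ) 1, ‖P n z‖ ≤ 1)
    (hlim : ∀ z ∈ ball (0 : ℂ) 1, Tendsto (fun n => P n z) atTop (𝓝 (B z)))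
    (hcoef : ∀ j < N, ∃ C, 0 ≤ C ∧ ∀ n, ‖iterSlope j (P n) 1‖ ≤ C)
    (hmean : ∃ C, ∀ n, circleMeanSq (iterSlope N (P n)) 1 ≤ C) :
    ∃ (g : ℂ → ℂ) (p : Polynomial ℂ), MemHardy2 g ∧ p.degree < (N : ℕ) ∧
      ∀ z ∈ ball (0 : ℂ) 1, B z = (z - 1) ^ N * g z + p.eval z := by
  obtain ⟨C, hC⟩ := hmean
  have hcoef' : ∀ j : Fin N, ∃ C, 0 ≤ C ∧ ∀ n, ‖iterSlope j (P n) 1‖ ≤ C := fun j => hcoef j j.2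
  choose D hD0 hD using hcoef'
  set c : ℕ → Fin N → ℂ := fun n j => iterSlope j (P n) 1 with hc
  have hcb : ∀ n, c n ∈ closedBall (0 : Fin N → ℂ) (∑ j, D j) := fun n => by
    rw [mem_closedBall_zero_iff, pi_norm_le_iff_of_nonneg (Finset.sum_nonneg fun j _ => hD0 j)]
    exact fun j => (hD j n).trans
      (Finset.single_le_sum (fun i _ => hD0 i) (Finset.mem_univ j))
  obtain ⟨α, -, φ, hφ, hα⟩ := tendsto_subseq_of_bounded isBounded_closedBall hcb
  have hα' : ∀ j, Tendsto (fun n => c (φ n) j) atTop (𝓝 (α j)) := fun j =>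
    (tendsto_pi_nhds.1 hα) j
  set p : Polynomial ℂ := ∑ j : Fin N, Polynomial.C (α j) * (X - 1) ^ (j : ℕ) with hp
  have hpeval : ∀ z, p.eval z = ∑ j : Fin N, α j * (z - 1) ^ (j : ℕ) := fun z => by
    simp [hp, Polynomial.eval_finsetSum]
  have hpdeg : p.degree < (N : ℕ) := by
    rw [← Polynomial.mem_degreeLT]
    refine Submodule.sum_mem _ fun j _ => Polynomial.mem_degreeLT.2 ?_
    rw [← Polynomial.smul_eq_C_mul]
    refine (Polynomial.degree_smul_le _ _).trans_lt ?_
    rw [← map_one Polynomial.C, Polynomial.degree_pow, Polynomial.degree_X_sub_C, nsmul_one]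
    exact_mod_cast j.2
  have hne : ∀ z ∈ ball (0 : ℂ) 1, z - 1 ≠ 0 := fun z hz h => by
    rw [sub_eq_zero.1 h, mem_ball_zero_iff, norm_one] at hz
    exact lt_irrefl _ hz
  have htaylor : ∀ n, ∀ z ∈ ball (0 : ℂ) 1, iterSlope N (P n) z =
      (P n z - ∑ j, c n j * (z - 1) ^ (j : ℕ)) / (z - 1) ^ N := fun n z hz => by
    rw [eq_div_iff (pow_ne_zero _ (hne z hz)), hc,
      Fin.sum_univ_eq_sum_range (fun j => iterSlope j (P n) 1 * (z - 1) ^ j)]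
    linear_combination -(eq_sum_add_pow_mul_iterSlope (P n) N z)
  set g : ℂ → ℂ := fun z => (B z - p.eval z) / (z - 1) ^ N with hg
  have hBd := differentiableOn_of_tendsto_of_norm_le_one hP hle hlim
  have hgd : DifferentiableOn ℂ g (ball 0 1) :=
    (hBd.sub p.differentiable.differentiableOn).div (by fun_prop) fun z hz =>
      pow_ne_zero _ (hne z hz)
  refine ⟨g, p, memHardy2_of_circleMeanSq_le hgd (C := C) fun r hr0 hr1 => ?_, hpdeg,
    fun z hz => ?_⟩
  · have hball : ∀ z ∈ sphere (0 : ℂ) r, z ∈ ball (0 : ℂ) 1 := fun z hz => by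
      rw [mem_ball_zero_iff, mem_sphere_zero_iff_norm.1 hz]
      exact hr1
    refine circleMeanSq_le_of_tendsto (F := fun n => iterSlope N (P (φ n)))
      (M := (1 + ∑ j : Fin N, D j * 2 ^ (j : ℕ)) / (1 - r) ^ N)
      (fun n => (hP _).iterSlope N) hr0 hr1 (fun n => hC _) (fun n z hz => ?_) fun z hz => ?_
    · have hzr := mem_sphere_zero_iff_norm.1 hz
      have hz1 : z ∈ ball (0 : ℂ) 1 := hball z hz
      have h2 : ‖z - 1‖ ≤ 2 := (norm_sub_le _ _).trans (by rw [hzr, norm_one]; linarith)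
      have hr : 0 < 1 - r := by linarith
      rw [htaylor _ z hz1, norm_div, norm_pow]
      have hnum : ‖P (φ n) z - ∑ j, c (φ n) j * (z - 1) ^ (j : ℕ)‖ ≤
          1 + ∑ j : Fin N, D j * 2 ^ (j : ℕ) := by
        refine (norm_sub_le _ _).trans
          (add_le_add (hle _ z (ball_subset_closedBall hz1)) (norm_sum_le_of_le _ fun j _ => ?_))
        rw [norm_mul, norm_pow]
        exact mul_le_mul (hD j _) (pow_le_pow_left₀ (norm_nonneg _) h2 _) (by positivity) (hD0 j)
      exact div_le_div₀ ((norm_nonneg _).trans hnum) hnum (by positivity)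
        (pow_le_pow_left₀ hr.le (one_sub_le_norm_sub_one hzr.le) _)
    · have hz1 : z ∈ ball (0 : ℂ) 1 := hball z hz
      simp only [htaylor _ z hz1, hg, hpeval]
      refine Tendsto.div_const (((hlim z hz1).comp hφ.tendsto_atTop).sub ?_) _
      exact tendsto_finsetSum _ fun j _ => (hα' j).mul_const _
  · rw [hg]
    simp only
    rw [mul_div_cancel₀ _ (pow_ne_zero _ (hne z hz)), sub_add_cancel]

lemma one_sub_prod_le_sum (x : ℕ → ℝ) (h0 : ∀ k, 0 ≤ x k) (h1 : ∀ k, x k ≤ 1) (n : ℕ) :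
    1 - ∏ k ∈ Finset.range n, x k ≤ ∑ k ∈ Finset.range n, (1 - x k) := by
  induction n with
  | zero => simp
  | succ n ih =>
    rw [Finset.prod_range_succ, Finset.sum_range_succ]
    have hp : ∏ k ∈ Finset.range n, x k ≤ 1 := Finset.prod_le_one (fun k _ => h0 k) fun k _ => h1 k
    nlinarith [h0 n, h1 n]

lemma norm_one_sub_le_two_mul {a : ℂ} (ha : ‖a‖ < 1) {r : ℝ} (hr0 : 0 ≤ r) (hr1 : r ≤ 1) :
    ‖1 - a‖ ≤ 2 * ‖1 - (starRingEnd ℂ) a * r‖ := by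
  rw [← norm_one_sub_conj]
  have h1 : 1 - r ≤ ‖1 - (starRingEnd ℂ) a * r‖ := by
    have := norm_sub_norm_le (1 : ℂ) ((starRingEnd ℂ) a * r)
    rw [norm_one, norm_mul, RCLike.norm_conj, Complex.norm_of_nonneg hr0] at this
    nlinarith
  have h2 : ‖1 - (starRingEnd ℂ) a‖ ≤
      ‖1 - (starRingEnd ℂ) a * r‖ + ‖(starRingEnd ℂ) a * (1 - r : ℝ)‖ := by
    refine le_of_eq_of_le ?_ (norm_sub_le _ _)
    congr 1
    push_cast
    ring
  rw [norm_mul, RCLike.norm_conj, Complex.norm_of_nonneg (by linarith)] at h2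
  nlinarith [norm_nonneg a]

lemma one_sub_norm_sq_blaschkeFactor_le {a : ℂ} (ha : ‖a‖ < 1) (ha0 : a ≠ 0) {r : ℝ}
    (hr0 : 0 ≤ r) (hr1 : r ≤ 1) :
    1 - ‖blaschkeFactor a r‖ ^ 2 ≤ 4 * (1 - r ^ 2) * ((1 - ‖a‖ ^ 2) / ‖1 - a‖ ^ 2) := by
  have hr : (r : ℂ) ∈ closedBall (0 : ℂ) 1 := by
    rw [mem_closedBall_zero_iff, Complex.norm_of_nonneg hr0]
    exact hr1
  rw [norm_sq_blaschkeFactor ha ha0 hr, Complex.norm_of_nonneg hr0]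
  have h1 : 0 < ‖1 - (starRingEnd ℂ) a * r‖ := norm_pos_iff.2 (one_sub_conj_mul_ne_zero ha hr)
  have h2 : 0 < ‖1 - a‖ := norm_pos_iff.2 fun h => by
    rw [← sub_eq_zero.1 h, norm_one] at ha
    exact lt_irrefl _ ha
  have h3 := norm_one_sub_le_two_mul ha hr0 hr1
  have h4 : 0 ≤ 1 - ‖a‖ ^ 2 := by nlinarith [norm_nonneg a]
  have h5 : 0 ≤ 1 - r ^ 2 := by nlinarith
  rw [mul_div_assoc', div_le_div_iff₀ (by positivity) (by positivity)]
  have h6 : ‖1 - a‖ ^ 2 ≤ 4 * ‖1 - (starRingEnd ℂ) a * r‖ ^ 2 := by nlinarith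
  nlinarith [mul_le_mul_of_nonneg_left h6 (mul_nonneg h4 h5)]

lemma div_pow_le_of_le_two {x y : ℝ} (hx : 0 < x) (hx2 : x ≤ 2) (hy : 0 ≤ y) {i N : ℕ}
    (hi : i ≤ 2 * N) : y / x ^ i ≤ 4 ^ N * (y / x ^ (2 * N)) := by
  rw [mul_div_assoc', div_le_div_iff₀ (by positivity) (by positivity)]
  have h1 : x ^ (2 * N) = x ^ (2 * N - i) * x ^ i := by rw [← pow_add, Nat.sub_add_cancel hi]
  have h2 : x ^ (2 * N - i) ≤ 4 ^ N := by
    calc x ^ (2 * N - i) ≤ 2 ^ (2 * N - i) := pow_le_pow_left₀ hx.le hx2 _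
      _ ≤ 2 ^ (2 * N) := pow_le_pow_right₀ one_le_two (Nat.sub_le _ _)
      _ = 4 ^ N := by rw [pow_mul]; norm_num
  rw [h1]
  have : 0 ≤ y * x ^ i := by positivity
  nlinarith [mul_le_mul_of_nonneg_right h2 this]

/-- **Lemma.** Let `N ≥ 1` and let `(λ n)` be a sequence in `𝔻 ∖ {0}` with
`∑_n (1-|λ n|²)/|1-λ n|^{2N} < ∞` (which implies the Blaschke condition, so the Blaschke
product `B_Λ` converges on `𝔻`).  Then there are `g ∈ H²` and a polynomial `p` with
`deg p < N` such that `B_Λ(z) = (z-1)^N g(z) + p(z)` on `𝔻` (i.e. `D₁^N(B_Λ) < ∞`);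
moreover `lim_{r→1⁻} |B_Λ(r)| = 1`. -/
theorem statement9 (N : ℕ) (hN : 1 ≤ N)
    (lam : ℕ → ℂ) (hlam : ∀ n, ‖lam n‖ < 1 ∧ lam n ≠ 0)
    (hsum : Summable fun n => (1 - ‖lam n‖ ^ 2) / ‖1 - lam n‖ ^ (2 * N))
    -- `B` is the Blaschke product with zeros `lam`, the limit of the partial products on `𝔻`
    (B : ℂ → ℂ)
    (hB : ∀ z ∈ ball (0 : ℂ) 1,
      Tendsto (fun n => ∏ k ∈ range n,
          ((‖lam k‖ : ℂ) / lam k) * ((lam k - z) / (1 - (starRingEnd ℂ) (lam k) * z)))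
        atTop (𝓝 (B z))) :
    (∃ (g : ℂ → ℂ) (p : Polynomial ℂ), MemHardy2 g ∧ p.degree < (N : ℕ) ∧
      ∀ z ∈ ball (0 : ℂ) 1, B z = (z - 1) ^ N * g z + p.eval z) ∧
    Tendsto (fun r : ℝ => ‖B (r : ℂ)‖) (nhdsWithin 1 (Set.Iio 1)) (𝓝 1) := by
  set b : ℕ → ℂ → ℂ := fun n => blaschkeFactor (lam n) with hb
  set s : ℕ → ℝ := fun n => (1 - ‖lam n‖ ^ 2) / ‖1 - lam n‖ ^ (2 * N) with hs
  have hBP : ∀ z ∈ ball (0 : ℂ) 1, Tendsto (fun n => partialProd b n z) atTop (𝓝 (B z)) := hB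
  have hinner : ∀ n, IsInner (b n) := fun n => isInner_blaschkeFactor (hlam n).1 (hlam n).2
  have hP := isInner_partialProd hinner
  have hle : ∀ n, ∀ z ∈ closedBall (0 : ℂ) 1, ‖partialProd b n z‖ ≤ 1 := fun n z hz => by
    rw [partialProd, norm_prod]
    exact Finset.prod_le_one (fun k _ => norm_nonneg _) fun k _ =>
      norm_blaschkeFactor_le_one (hlam k).1 (hlam k).2 hz
  have hnum : ∀ n, 0 ≤ 1 - ‖lam n‖ ^ 2 := fun n => by
    nlinarith [norm_nonneg (lam n), (hlam n).1]
  have hpos : ∀ n, 0 < ‖1 - lam n‖ := fun n => norm_pos_iff.2 fun h => by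
    have := (hlam n).1
    rw [← sub_eq_zero.1 h, norm_one] at this
    exact lt_irrefl _ this
  have hle2 : ∀ n, ‖1 - lam n‖ ≤ 2 := fun n =>
    (norm_sub_le _ _).trans (by rw [norm_one]; linarith [(hlam n).1])
  set t : ℕ → ℝ := fun n => 4 ^ N * s n with ht
  have ht0 : ∀ n, 0 ≤ t n := fun n =>
    mul_nonneg (by positivity) (div_nonneg (hnum n) (by positivity))
  have hts : Summable t := hsum.mul_left _
  have hst : ∀ n i, i ≤ 2 * N → (1 - ‖lam n‖ ^ 2) / ‖1 - lam n‖ ^ i ≤ t n := fun n i hi =>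
    div_pow_le_of_le_two (hpos n) (hle2 n) (hnum n) hi
  have h1 : ∀ n j, j + 1 < N → ‖iterSlope (j + 1) (b n) 1‖ ≤ t n := fun n j hj =>
    (norm_iterSlope_blaschkeFactor_one (hlam n).1 (hlam n).2 j).trans (hst n _ (by omega))
  have h2 : ∀ n j, j < N → circleMeanSq (iterSlope (j + 1) (b n)) 1 ≤ t n := fun n j hj =>
    (circleMeanSq_iterSlope_blaschkeFactor (hlam n).1 (hlam n).2 j).trans (hst n _ (by omega))
  refine ⟨exists_memHardy2_of_tendsto (fun n => (hP n).analytic) hle hBP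
    (exists_norm_iterSlope_partialProd_le hinner ht0 hts h1) ?_, ?_⟩
  · obtain ⟨C, -, hC⟩ := exists_circleMeanSq_iterSlope_partialProd_le hinner ht0 hts h1 h2
      (N - 1) (by omega)
    rw [Nat.sub_add_cancel hN] at hC
    exact ⟨C, hC⟩
  · set T := ∑' n, t n with hT
    have hbound : ∀ r : ℝ, 0 < r → r < 1 →
        1 - 4 * (1 - r ^ 2) * T ≤ ‖B r‖ ∧ ‖B r‖ ≤ 1 := fun r hr0 hr1 => by
      have hr : (r : ℂ) ∈ ball (0 : ℂ) 1 := by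
        rw [mem_ball_zero_iff, Complex.norm_of_nonneg hr0.le]
        exact hr1
      have hr' := ball_subset_closedBall hr
      have hlim := (hBP r hr).norm
      refine ⟨ge_of_tendsto' hlim fun n => ?_, le_of_tendsto' hlim fun n => hle n r hr'⟩
      have hr2 : 0 ≤ 4 * (1 - r ^ 2) := by nlinarith
      have hprod := one_sub_prod_le_sum (fun k => ‖b k r‖ ^ 2) (fun k => by positivity)
        (fun k => pow_le_one₀ (norm_nonneg _)
          (norm_blaschkeFactor_le_one (hlam k).1 (hlam k).2 hr')) n
      have hsumle : ∑ k ∈ Finset.range n, (1 - ‖b k r‖ ^ 2) ≤ 4 * (1 - r ^ 2) * T :=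
        calc ∑ k ∈ Finset.range n, (1 - ‖b k r‖ ^ 2)
            ≤ ∑ k ∈ Finset.range n, 4 * (1 - r ^ 2) * t k :=
              Finset.sum_le_sum fun k _ =>
                (one_sub_norm_sq_blaschkeFactor_le (hlam k).1 (hlam k).2 hr0.le hr1.le).trans
                  (mul_le_mul_of_nonneg_left (hst k 2 (by omega)) hr2)
          _ ≤ 4 * (1 - r ^ 2) * T := by
              rw [← Finset.mul_sum]
              exact mul_le_mul_of_nonneg_left (hts.sum_le_tsum _ fun k _ => ht0 k) hr2
      have hsq : ∏ k ∈ Finset.range n, ‖b k r‖ ^ 2 = ‖partialProd b n r‖ ^ 2 := by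
        rw [partialProd, norm_prod, Finset.prod_pow]
      rw [hsq] at hprod
      nlinarith [norm_nonneg (partialProd b n r), hle n r hr']
    have hev : ∀ᶠ r : ℝ in 𝓝[<] 1, 0 < r ∧ r < 1 := by
      filter_upwards [Ioo_mem_nhdsLT (zero_lt_one' ℝ)] with r hr using hr
    have hlow : Tendsto (fun r : ℝ => 1 - 4 * (1 - r ^ 2) * T) (𝓝[<] 1) (𝓝 1) := by
      have hcont : Continuous fun r : ℝ => 1 - 4 * (1 - r ^ 2) * T := by fun_prop
      have := hcont.tendsto 1
      simp only [one_pow, sub_self, mul_zero, zero_mul, sub_zero] at this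
      exact this.mono_left nhdsWithin_le_nhds
    exact tendsto_of_tendsto_of_tendsto_of_le_of_le' hlow tendsto_const_nhds
      (hev.mono fun r hr => (hbound r hr.1 hr.2).1) (hev.mono fun r hr => (hbound r hr.1 hr.2).2)
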